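/- Let g be the Kac-Moody algebra of an indecomposable symmetrizable generalized Cartan matrix A, (I,J) a C-admissible pair, and g^J the associated C-admissible subalgebra. Then g is an integrable g^J-module under the adjoint action, with finite multiplicities: for every weight λ of the adjoint action of h^J on g (including λ = 0), the weight space V_λ = {x∈g : [h,x] = ⟨λ,h⟩x for all h∈h^J} is finite dimensional. -/

import Mathlib

attribute [local instance] Classical.propDecidable

noncomputable section

namespace KMG

open Module

/-! ### Generalized Cartan matrices -/

/-- `A` is a generalized Cartan matrix. -/
def IsGCM {I : Type*} (A : Matrix I I ℤ) : Prop :=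
  (∀ i, A i i = 2) ∧ (∀ i j, i ≠ j → A i j ≤ 0) ∧ ∀ i j, A i j = 0 → A j i = 0

/-- `A` is indecomposable. -/
def Indecomposable {I : Type*} (A : Matrix I I ℤ) : Prop :=
  ∀ s : Set I, s.Nonempty → sᶜ.Nonempty → ∃ i ∈ s, ∃ j ∈ sᶜ, A i j ≠ 0

/-- `A` is symmetrizable: `D A` is symmetric for an invertible diagonal matrix `D`. -/
def Symmetrizable {I : Type*} (A : Matrix I I ℤ) : Prop :=
  ∃ d : I → ℚ, (∀ i, d i ≠ 0) ∧ ∀ i j, d i * (A i j : ℚ) = d j * (A j i : ℚ)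

/-- The principal submatrix of `A` indexed by a subset `S`. -/
def restrictM {I : Type*} (A : Matrix I I ℤ) (S : Set I) : Matrix S S ℤ :=
  fun i j => A i.1 j.1

/-- `A` is of finite type: `A u > 0` for some `u > 0` (Kac, Thm. 4.3). -/
def IsFiniteType {I : Type*} (A : Matrix I I ℤ) : Prop :=
  ∃ u : I → ℚ, (∀ i, 0 < u i) ∧ ∀ i, 0 < ∑ᶠ j, (A i j : ℚ) * u j

/-- `A` is of affine type: `A` indecomposable and `A u = 0` for some `u > 0`. -/
def IsAffineType {I : Type*} (A : Matrix I I ℤ) : Prop :=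
  Indecomposable A ∧ ∃ u : I → ℚ, (∀ i, 0 < u i) ∧ ∀ i, ∑ᶠ j, (A i j : ℚ) * u j = 0

/-- `A` is of indefinite type: `A u < 0` for some `u > 0`. -/
def IsIndefiniteType {I : Type*} (A : Matrix I I ℤ) : Prop :=
  ∃ u : I → ℚ, (∀ i, 0 < u i) ∧ ∀ i, ∑ᶠ j, (A i j : ℚ) * u j < 0

/-- The corank of a generalized Cartan matrix. -/
def gcmCorank {I : Type*} [Fintype I] [DecidableEq I] (A : Matrix I I ℤ) : ℕ :=
  Fintype.card I - (A.map ((↑) : ℤ → ℚ)).rank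

/-- The connected component of the vertex `k` in the subdiagram of the Dynkin diagram of `A`
with vertex set `S`. -/
def cmpnt {I : Type*} (A : Matrix I I ℤ) (S : Set I) (k : I) : Set I :=
  {i | i ∈ S ∧ Relation.ReflTransGen (fun x y => x ∈ S ∧ y ∈ S ∧ A x y ≠ 0) k i}

/-- `A` is hyperbolic: deleting any one vertex of the Dynkin diagram leaves a disjoint union
of diagrams of finite or affine type. -/
def IsHyperbolic {I : Type*} (A : Matrix I I ℤ) : Prop :=
  ∀ i₀ k : I, k ≠ i₀ →
    IsFiniteType (restrictM A (cmpnt A {i | i ≠ i₀} k)) ∨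
      IsAffineType (restrictM A (cmpnt A {i | i ≠ i₀} k))

/-- `A` is Lorentzian: `A` is nonsingular and its symmetrization has signature `(+,...,+,-)`. -/
def IsLorentzian {I : Type*} [Fintype I] [DecidableEq I] (A : Matrix I I ℤ) : Prop :=
  IsUnit (A.map ((↑) : ℤ → ℚ)).det ∧
    ∃ d : I → ℚ, (∀ i, 0 < d i) ∧ (∀ i j, d i * (A i j : ℚ) = d j * (A j i : ℚ)) ∧
      ∃ P : Matrix I I ℝ, IsUnit P.det ∧ ∃ i₀ : I,
        P.transpose * (Matrix.of fun i j => ((d i : ℝ) * (A i j : ℝ))) * P =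
          Matrix.diagonal fun i => if i = i₀ then (-1 : ℝ) else 1

/-! ### Weight spaces -/

variable {g : Type*} [LieRing g] [LieAlgebra ℂ g]

/-- The weight space of weight `χ` for the adjoint action on `g` of a space `V` mapping to `g`
by `ι`. -/
def wtSpaceι {V : Type*} [AddCommGroup V] [Module ℂ V] (ι : V →ₗ[ℂ] g)
    (χ : Module.Dual ℂ V) : Submodule ℂ g where
  carrier := {x | ∀ v : V, ⁅ι v, x⁆ = χ v • x}
  add_mem' := fun ha hb v => by rw [lie_add, ha v, hb v, smul_add]
  zero_mem' := fun v => by rw [lie_zero, smul_zero]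
  smul_mem' := fun c x hx v => by rw [lie_smul, hx v, smul_comm]

/-! ### Kac-Moody algebras -/

/-- A (symmetrizable) Kac-Moody algebra structure on the Lie algebra `g`, for the generalized
Cartan matrix `A` indexed by `I` : a realization `(H, root, coroot)` of `A` together with
Chevalley generators `e i`, `f i` satisfying the Chevalley-Serre relations, such that `g` is
generated by `H` and the `e i, f i`, is diagonalizable under `H`, with `0`-weight space `H`. -/
structure KacMoodyAlgebra {I : Type*} [Fintype I] [DecidableEq I] (A : Matrix I I ℤ)
    (g : Type*) [LieRing g] [LieAlgebra ℂ g] : Type _ where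
  H : Submodule ℂ g
  root : I → Module.Dual ℂ H
  coroot : I → H
  e : I → g
  f : I → g
  findimH : FiniteDimensional ℂ H
  finrankH : Module.finrank ℂ H = Fintype.card I + gcmCorank A
  indepRoot : LinearIndependent ℂ root
  indepCoroot : LinearIndependent ℂ coroot
  pairing : ∀ i j, root j (coroot i) = (A i j : ℂ)
  abelian : ∀ x y : H, ⁅(x : g), (y : g)⁆ = 0
  lie_e : ∀ (x : H) (i : I), ⁅(x : g), e i⁆ = root i x • e i
  lie_f : ∀ (x : H) (i : I), ⁅(x : g), f i⁆ = -(root i x) • f i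
  e_f : ∀ i j, ⁅e i, f j⁆ = if j = i then ((coroot i : g)) else 0
  serre_e : ∀ i j, i ≠ j →
    ((LieAlgebra.ad ℂ g (e i)) ^ (1 - A i j).toNat) (e j) = 0
  serre_f : ∀ i j, i ≠ j →
    ((LieAlgebra.ad ℂ g (f i)) ^ (1 - A i j).toNat) (f j) = 0
  generates : LieSubalgebra.lieSpan ℂ g ((H : Set g) ∪ Set.range e ∪ Set.range f) = ⊤
  weight_decomp : ⨆ χ : Module.Dual ℂ H, wtSpaceι H.subtype χ = ⊤
  zero_weight : wtSpaceι H.subtype (0 : Module.Dual ℂ H) = H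

variable {I : Type*} [Fintype I] [DecidableEq I] {A : Matrix I I ℤ}

/-- The root system of a Kac-Moody algebra: nonzero weights of the adjoint action of the
Cartan subalgebra. -/
def Delta (G : KacMoodyAlgebra A g) : Set (Module.Dual ℂ G.H) :=
  {χ | χ ≠ 0 ∧ wtSpaceι G.H.subtype χ ≠ ⊥}

/-- The positive roots with respect to the standard root basis. -/
def posRoots (G : KacMoodyAlgebra A g) : Set (Module.Dual ℂ G.H) :=
  {χ ∈ Delta G | ∃ c : I → ℕ, χ = ∑ i, (c i : ℂ) • G.root i}

/-- The real roots : the orbit of the simple roots under the Weyl group. -/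
inductive IsRealRoot (G : KacMoodyAlgebra A g) : Module.Dual ℂ G.H → Prop
  | simple (i : I) : IsRealRoot G (G.root i)
  | reflect (i : I) (χ : Module.Dual ℂ G.H) :
      IsRealRoot G χ → IsRealRoot G (χ - χ (G.coroot i) • G.root i)

/-- The subalgebra `g(S)` generated by the root spaces `g_{± α_i}`, `i ∈ S`. -/
def gS (G : KacMoodyAlgebra A g) (S : Set I) : LieSubalgebra ℂ g :=
  LieSubalgebra.lieSpan ℂ g ({x | ∃ i ∈ S, x = G.e i} ∪ {x | ∃ i ∈ S, x = G.f i})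

/-- The subspace `h^J = {h ∈ h | ⟨α_j, h⟩ = 0 ∀ j ∈ J}`. -/
def hJsub (G : KacMoodyAlgebra A g) (J : Set I) : Submodule ℂ G.H :=
  ⨅ j ∈ J, LinearMap.ker (G.root j)

/-- `Hk` is the canonical semisimple element attached to `k` and the component `S = I_k` :
it lies in the span of the coroots from `S` and satisfies `⟨α_i, H_k⟩ = 2 δ_{i,k}` on `S`. -/
def IsHGen (G : KacMoodyAlgebra A g) (S : Set I) (k : I) (Hk : G.H) : Prop :=
  Hk ∈ Submodule.span ℂ (G.coroot '' S) ∧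
    ∀ i ∈ S, G.root i Hk = if i = k then 2 else 0

/-- `g(S)` is `A₁`-graded by the `sl₂`-triple with semisimple element `Hk` :
`ad Hk` has only eigenvalues `0, 2, -2` on `g(S)`. -/
def A1GradedBy (G : KacMoodyAlgebra A g) (S : Set I) (Hk : g) : Prop :=
  ∀ x ∈ gS G S, x ∈ Module.End.eigenspace (LieAlgebra.ad ℂ g Hk) 0 ⊔
    Module.End.eigenspace (LieAlgebra.ad ℂ g Hk) 2 ⊔
      Module.End.eigenspace (LieAlgebra.ad ℂ g Hk) (-2)

/-- The pair `(I_k, J_k)` (for `I_k` the connected component of `k` in `J ∪ {k}`) is an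
irreducible `C`-admissible pair. -/
def CAdmissibleComponent (G : KacMoodyAlgebra A g) (J : Set I) (k : I) : Prop :=
  IsFiniteType (restrictM A (cmpnt A (J ∪ {k}) k)) ∧
    ∃ Hk : G.H, IsHGen G (cmpnt A (J ∪ {k}) k) k Hk ∧
      ∃ E F : g, E ∈ gS G (cmpnt A (J ∪ {k}) k) ∧ F ∈ gS G (cmpnt A (J ∪ {k}) k) ∧
        IsSl2Triple (Hk : g) E F ∧ A1GradedBy G (cmpnt A (J ∪ {k}) k) (Hk : g)

/-- The data of a `C`-admissible pair `(I, J)` : for each `k ∉ J`, the component `I_k` is of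
finite type and carries an `sl₂`-triple `(E_k, H_k, F_k)` which `A₁`-grades `g(I_k)`. -/
structure CAdmissibleData (G : KacMoodyAlgebra A g) (J : Set I) : Type _ where
  finJ : IsFiniteType (restrictM A J)
  Hc : {k : I // k ∉ J} → G.H
  E : {k : I // k ∉ J} → g
  F : {k : I // k ∉ J} → g
  finIk : ∀ k : {k : I // k ∉ J}, IsFiniteType (restrictM A (cmpnt A (J ∪ {k.1}) k.1))
  isHGen : ∀ k, IsHGen G (cmpnt A (J ∪ {k.1}) k.1) k.1 (Hc k)
  memE : ∀ k, E k ∈ gS G (cmpnt A (J ∪ {k.1}) k.1)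
  memF : ∀ k, F k ∈ gS G (cmpnt A (J ∪ {k.1}) k.1)
  sl2 : ∀ k, IsSl2Triple ((Hc k : g)) (E k) (F k)
  a1 : ∀ k, A1GradedBy G (cmpnt A (J ∪ {k.1}) k.1) ((Hc k : g))

/-- `(I,J)` is a `C`-admissible pair. -/
def CAdmissiblePair (G : KacMoodyAlgebra A g) (J : Set I) : Prop :=
  Nonempty (CAdmissibleData G J)

/-- The data of a `C`-admissible pair `(Itot, J)` for a subdiagram `Itot ⊆ I`. -/
structure CAdmissibleDataIn (G : KacMoodyAlgebra A g) (Itot J : Set I) : Type _ where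
  subJ : J ⊆ Itot
  finJ : IsFiniteType (restrictM A J)
  Hc : {k : I // k ∈ Itot ∧ k ∉ J} → G.H
  E : {k : I // k ∈ Itot ∧ k ∉ J} → g
  F : {k : I // k ∈ Itot ∧ k ∉ J} → g
  finIk : ∀ k : {k : I // k ∈ Itot ∧ k ∉ J},
    IsFiniteType (restrictM A (cmpnt A (J ∪ {k.1}) k.1))
  isHGen : ∀ k, IsHGen G (cmpnt A (J ∪ {k.1}) k.1) k.1 (Hc k)
  memE : ∀ k, E k ∈ gS G (cmpnt A (J ∪ {k.1}) k.1)
  memF : ∀ k, F k ∈ gS G (cmpnt A (J ∪ {k.1}) k.1)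
  sl2 : ∀ k, IsSl2Triple ((Hc k : g)) (E k) (F k)
  a1 : ∀ k, A1GradedBy G (cmpnt A (J ∪ {k.1}) k.1) ((Hc k : g))

/-- The `C`-admissible subalgebra `g^J` : generated by `h^J` and the `E_k, F_k`. -/
def CAdmissibleData.gJ {G : KacMoodyAlgebra A g} {J : Set I} (D : CAdmissibleData G J) :
    LieSubalgebra ℂ g :=
  LieSubalgebra.lieSpan ℂ g
    ((((hJsub G J).map G.H.subtype : Submodule ℂ g) : Set g) ∪ Set.range D.E ∪ Set.range D.F)

/-- `GJ` is "the" Kac-Moody structure on `g^J` associated to a `C`-admissible pair: its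
Cartan subalgebra is `h^J`, its coroots are the `H_k` and its Chevalley generators are the
`E_k, F_k`; the matrix `A'` is `A^J`, i.e. `a'_{k,l} = ⟨α_l, H_k⟩`. -/
def CAdmissibleData.IsAssocKM {G : KacMoodyAlgebra A g} {J : Set I} (D : CAdmissibleData G J)
    {A' : Matrix {k : I // k ∉ J} {k : I // k ∉ J} ℤ}
    (GJ : KacMoodyAlgebra A' ↥D.gJ) : Prop :=
  (∀ k l, (A' k l : ℂ) = G.root l.1 (D.Hc k)) ∧
  GJ.H.map D.gJ.toSubmodule.subtype = (hJsub G J).map G.H.subtype ∧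
  (∀ k, ((GJ.coroot k : ↥D.gJ) : g) = ((D.Hc k : ↥G.H) : g)) ∧
  (∀ k, ((GJ.e k : ↥D.gJ) : g) = D.E k) ∧ (∀ k, ((GJ.f k : ↥D.gJ) : g) = D.F k)

/-! ### Finite gradations -/

/-- `g` is finitely `Σ`-graded, where `Σ` is the root system of the Kac-Moody algebra `m`
(with Kac-Moody structure `M`) and `m` is embedded in `g` by `φ` (the grading subalgebra is
the image of `φ`): `g` is the sum of the weight spaces `V_γ`, `γ ∈ Σ ∪ {0}`, of the adjoint
action of the Cartan subalgebra of `m`, and each `V_γ` is finite dimensional. -/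
def IsFinGrading {S : Type*} [Fintype S] [DecidableEq S] {B : Matrix S S ℤ}
    {m : Type*} [LieRing m] [LieAlgebra ℂ m] (M : KacMoodyAlgebra B m)
    (φ : m →ₗ⁅ℂ⁆ g) : Prop :=
  Function.Injective φ ∧
  (⨆ χ ∈ insert (0 : Module.Dual ℂ M.H) (Delta M),
      wtSpaceι (φ.toLinearMap ∘ₗ M.H.subtype) χ) = ⊤ ∧
  ∀ χ ∈ insert (0 : Module.Dual ℂ M.H) (Delta M),
      FiniteDimensional ℂ (wtSpaceι (φ.toLinearMap ∘ₗ M.H.subtype) χ)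

section Grading

variable {S : Type*} [Fintype S] [DecidableEq S] {B : Matrix S S ℤ}
variable {m : Type*} [LieRing m] [LieAlgebra ℂ m]

/-- The inclusion of the Cartan subalgebra of the grading subalgebra into the Cartan
subalgebra of `g` (given `a ⊆ h`). -/
def cartanIncl (G : KacMoodyAlgebra A g) (M : KacMoodyAlgebra B m) (φ : m →ₗ⁅ℂ⁆ g)
    (hle : M.H.map φ.toLinearMap ≤ G.H) : M.H →ₗ[ℂ] G.H :=
  LinearMap.codRestrict G.H (φ.toLinearMap ∘ₗ M.H.subtype)
    (fun x => hle (Submodule.mem_map_of_mem x.2))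

/-- The restriction `ρ_a(χ)` to the Cartan subalgebra `a` of `m` of a linear form `χ` on `h`. -/
def resD (G : KacMoodyAlgebra A g) (M : KacMoodyAlgebra B m) (φ : m →ₗ⁅ℂ⁆ g)
    (hle : M.H.map φ.toLinearMap ≤ G.H) (χ : Module.Dual ℂ G.H) : Module.Dual ℂ M.H :=
  χ.comp (cartanIncl G M φ hle)

/-- The restriction `ρ_a(α_i)` of the simple root `α_i` to `a`. -/
def resRoot (G : KacMoodyAlgebra A g) (M : KacMoodyAlgebra B m) (φ : m →ₗ⁅ℂ⁆ g)
    (hle : M.H.map φ.toLinearMap ≤ G.H) (i : I) : Module.Dual ℂ M.H :=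
  resD G M φ hle (G.root i)

/-- The root basis of `M` is adapted to the root basis of `G` :
`ρ_a(Δ⁺) ⊆ Σ⁺ ∪ {0}`. -/
def Adapted (G : KacMoodyAlgebra A g) (M : KacMoodyAlgebra B m) (φ : m →ₗ⁅ℂ⁆ g)
    (hle : M.H.map φ.toLinearMap ≤ G.H) : Prop :=
  ∀ χ ∈ posRoots G, resD G M φ hle χ = 0 ∨ resD G M φ hle χ ∈ posRoots M

/-- The set `J = {i ∈ I | ρ_a(α_i) = 0}`. -/
def Jof (G : KacMoodyAlgebra A g) (M : KacMoodyAlgebra B m) (φ : m →ₗ⁅ℂ⁆ g)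
    (hle : M.H.map φ.toLinearMap ≤ G.H) : Set I :=
  {i | resRoot G M φ hle i = 0}

/-- The set `Γ_s = {i ∈ I' | ρ_a(α_i) = γ_s}`. -/
def GammaOf (G : KacMoodyAlgebra A g) (M : KacMoodyAlgebra B m) (φ : m →ₗ⁅ℂ⁆ g)
    (hle : M.H.map φ.toLinearMap ≤ G.H) (s : S) : Set I :=
  {i | resRoot G M φ hle i = M.root s}

/-- The set `I'_re = {i ∈ I' | ρ_a(α_i) ∈ Π_a}`. -/
def IpRe (G : KacMoodyAlgebra A g) (M : KacMoodyAlgebra B m) (φ : m →ₗ⁅ℂ⁆ g)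
    (hle : M.H.map φ.toLinearMap ≤ G.H) : Set I :=
  {i | ∃ s : S, resRoot G M φ hle i = M.root s}

/-- The set `I'_im = {i ∈ I | ρ_a(α_i) ∉ Π_a ∪ {0}}`. -/
def IpIm (G : KacMoodyAlgebra A g) (M : KacMoodyAlgebra B m) (φ : m →ₗ⁅ℂ⁆ g)
    (hle : M.H.map φ.toLinearMap ≤ G.H) : Set I :=
  {i | resRoot G M φ hle i ≠ 0 ∧ ∀ s : S, resRoot G M φ hle i ≠ M.root s}

/-- The set `I_re` : union of the components `I_k`, `k ∈ I'_re`. -/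
def IreOf (G : KacMoodyAlgebra A g) (M : KacMoodyAlgebra B m) (φ : m →ₗ⁅ℂ⁆ g)
    (hle : M.H.map φ.toLinearMap ≤ G.H) : Set I :=
  {i | ∃ k ∈ IpRe G M φ hle, i ∈ cmpnt A (Jof G M φ hle ∪ {k}) k}

/-- `g` is maximally finitely graded: finitely graded, with `a ⊆ h`, the root basis of the
grading subalgebra adapted, and the corresponding sets `J` and `I'_im` empty. -/
def MaxFinGrading (G : KacMoodyAlgebra A g) (M : KacMoodyAlgebra B m) (φ : m →ₗ⁅ℂ⁆ g) : Prop :=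
  IsFinGrading M φ ∧ ∃ hle : M.H.map φ.toLinearMap ≤ G.H,
    Adapted G M φ hle ∧ Jof G M φ hle = ∅ ∧ IpIm G M φ hle = ∅

end Grading

/-- `(π, πv)` is a root basis (with generalized Cartan matrix `B`) of the root system `Rts`. -/
def IsRootBasis {V : Type*} [AddCommGroup V] [Module ℂ V] {S : Type*} [Fintype S]
    (B : Matrix S S ℤ) (Rts : Set (Module.Dual ℂ V)) (π : S → Module.Dual ℂ V)
    (πv : S → V) : Prop :=
  LinearIndependent ℂ π ∧ LinearIndependent ℂ πv ∧
  (∀ s t, π t (πv s) = (B s t : ℂ)) ∧ (∀ s, π s ∈ Rts) ∧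
  ∀ χ ∈ Rts, (∃ c : S → ℕ, χ = ∑ s, (c s : ℂ) • π s) ∨
    (∃ c : S → ℕ, χ = -∑ s, (c s : ℂ) • π s)

/-- `Bf` is a nondegenerate invariant symmetric bilinear form on `g`. -/
def InvariantForm (Bf : g →ₗ[ℂ] g →ₗ[ℂ] ℂ) : Prop :=
  (∀ x y, Bf x y = Bf y x) ∧ (∀ x y z, Bf ⁅x, y⁆ z = Bf x ⁅y, z⁆) ∧
  ∀ x, (∀ y, Bf x y = 0) → x = 0

/-- `Bf` is "the" invariant bilinear form of the Kac-Moody algebra `G` : nondegenerate,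
invariant, symmetric, with `(α_i∨, α_i∨)` a positive rational for all `i`. -/
def NormalizedInvForm (G : KacMoodyAlgebra A g) (Bf : g →ₗ[ℂ] g →ₗ[ℂ] ℂ) : Prop :=
  InvariantForm Bf ∧ ∀ i : I, ∃ q : ℚ, 0 < q ∧ Bf ((G.coroot i : g)) ((G.coroot i : g)) = (q : ℂ)

/-- `(e', f')` is a system of Chevalley generators for `G` (with the given Cartan subalgebra,
simple roots and coroots). -/
def IsChevalleyGens (G : KacMoodyAlgebra A g) (e' f' : I → g) : Prop :=
  (∀ (x : G.H) (i : I), ⁅(x : g), e' i⁆ = G.root i x • e' i) ∧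
  (∀ (x : G.H) (i : I), ⁅(x : g), f' i⁆ = -(G.root i x) • f' i) ∧
  (∀ i j, ⁅e' i, f' j⁆ = if j = i then ((G.coroot i : g)) else 0) ∧
  (∀ i j, i ≠ j → ((LieAlgebra.ad ℂ g (e' i)) ^ (1 - A i j).toNat) (e' j) = 0) ∧
  (∀ i j, i ≠ j → ((LieAlgebra.ad ℂ g (f' i)) ^ (1 - A i j).toNat) (f' j) = 0) ∧
  LieSubalgebra.lieSpan ℂ g ((G.H : Set g) ∪ Set.range e' ∪ Set.range f') = ⊤


/-- The subalgebra `g(I_re)` of `g` generated by `h_{I_re}` and the `e_i, f_i`, `i ∈ I_re`. -/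
def gIre (G : KacMoodyAlgebra A g) (Ire : Set I) (hIre : Submodule ℂ g) : LieSubalgebra ℂ g :=
  LieSubalgebra.lieSpan ℂ g
    ((hIre : Set g) ∪ {x | ∃ i ∈ Ire, x = G.e i} ∪ {x | ∃ i ∈ Ire, x = G.f i})

/-- `GI` is "the" Kac-Moody structure on `g(I_re)` : its Cartan subalgebra is `h_{I_re}`,
its coroots and Chevalley generators are the `α_i∨, e_i, f_i` of `g`, for `i ∈ I_re`. -/
def IsAssocKMIre (G : KacMoodyAlgebra A g) (Ire : Set I) (hIre : Submodule ℂ g)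
    {A'' : Matrix ↥Ire ↥Ire ℤ} (GI : KacMoodyAlgebra A'' ↥(gIre G Ire hIre)) : Prop :=
  GI.H.map (gIre G Ire hIre).toSubmodule.subtype = hIre ∧
  (∀ i, ((GI.coroot i : ↥(gIre G Ire hIre)) : g) = ((G.coroot i.1 : ↥G.H) : g)) ∧
  (∀ i, ((GI.e i : ↥(gIre G Ire hIre)) : g) = G.e i.1) ∧
  (∀ i, ((GI.f i : ↥(gIre G Ire hIre)) : g) = G.f i.1)

/-! ### Admissible quotients and maximal gradations -/

/-- `ρ : I → S` is an admissible quotient map for `A` : fibers are totally disconnected (MG1)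
and the column sums over a fiber are constant along fibers (MG2). -/
def AdmissibleQuotient {I S : Type*} (A : Matrix I I ℤ) (ρ : I → S) : Prop :=
  Function.Surjective ρ ∧
  (∀ k l, k ≠ l → ρ k = ρ l → A k l = 0) ∧
  ∀ s t : S, s ≠ t → ∀ j j', ρ j = t → ρ j' = t →
    ∑ᶠ i ∈ {i | ρ i = s}, A i j = ∑ᶠ i ∈ {i | ρ i = s}, A i j'

section Quotient

variable {S : Type*} [Fintype S] [DecidableEq S]

/-- `γ_s∨ = ∑_{k ∈ Γ_s} α_k∨`. -/
def gammaV (G : KacMoodyAlgebra A g) (ρ : I → S) (s : S) : G.H :=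
  ∑ᶠ k ∈ {k | ρ k = s}, G.coroot k

/-- `X̄_s = ∑_{k ∈ Γ_s} e_k`. -/
def Xbar (G : KacMoodyAlgebra A g) (ρ : I → S) (s : S) : g :=
  ∑ᶠ k ∈ {k | ρ k = s}, G.e k

/-- `Ȳ_s = ∑_{k ∈ Γ_s} f_k`. -/
def Ybar (G : KacMoodyAlgebra A g) (ρ : I → S) (s : S) : g :=
  ∑ᶠ k ∈ {k | ρ k = s}, G.f k

/-- The subalgebra `g^ρ` generated by `a` and the `X̄_s, Ȳ_s`. -/
def gRho (G : KacMoodyAlgebra A g) (ρ : I → S) (a : Submodule ℂ G.H) : LieSubalgebra ℂ g :=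
  LieSubalgebra.lieSpan ℂ g
    (((a.map G.H.subtype : Submodule ℂ g) : Set g) ∪ Set.range (Xbar G ρ) ∪
      Set.range (Ybar G ρ))

/-- `Gρ` is "the" Kac-Moody structure on `g^ρ` : its Cartan subalgebra is `a`, its coroots
are the `γ_s∨` and its Chevalley generators are the `X̄_s, Ȳ_s`. -/
def IsAssocKMrho (G : KacMoodyAlgebra A g) (ρ : I → S) (a : Submodule ℂ G.H)
    {Abar : Matrix S S ℤ} (Gρ : KacMoodyAlgebra Abar ↥(gRho G ρ a)) : Prop :=
  Gρ.H.map (gRho G ρ a).toSubmodule.subtype = a.map G.H.subtype ∧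
  (∀ s, ((Gρ.coroot s : ↥(gRho G ρ a)) : g) = ((gammaV G ρ s : ↥G.H) : g)) ∧
  (∀ s, ((Gρ.e s : ↥(gRho G ρ a)) : g) = Xbar G ρ s) ∧
  (∀ s, ((Gρ.f s : ↥(gRho G ρ a)) : g) = Ybar G ρ s)

end Quotient

end KMG

namespace KMG

/-! ### Symmetrizers and matrices of finite type -/

theorem exists_pos_symmetrizer {I : Type*} {A : Matrix I I ℤ} (hGCM : IsGCM A) (hSym : Symmetrizable A) :
    ∃ d : I → ℚ, (∀ i, 0 < d i) ∧ ∀ i j, d i * (A i j : ℚ) = d j * (A j i : ℚ) := by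
  obtain ⟨d, hd, h⟩ := hSym
  refine ⟨fun i => |d i|, fun i => abs_pos.2 (hd i), fun i j => ?_⟩
  by_cases hij : i = j
  · subst hij; rfl
  · have h1 : (A i j : ℚ) ≤ 0 := by exact_mod_cast hGCM.2.1 i j hij
    have h2 : (A j i : ℚ) ≤ 0 := by exact_mod_cast hGCM.2.1 j i (Ne.symm hij)
    have h3 := congrArg abs (h i j)
    rw [abs_mul, abs_mul, abs_of_nonpos h1, abs_of_nonpos h2] at h3
    linarith

section Words

variable {I : Type*} [DecidableEq I]

/-- The number of occurrences of each letter in a word. -/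
def letterCount (w : List I) : I → ℤ := fun i => w.count i

theorem letterCount_cons (i : I) (w : List I) :
    letterCount (i :: w) = Pi.single i 1 + letterCount w := by
  funext j
  by_cases h : i = j
  · subst h; simp [letterCount, add_comm]
  · simp [letterCount, h]

theorem letterCount_nonneg (w : List I) : 0 ≤ letterCount w := fun i => by
  simp [letterCount]

end Words

section Multiplicities

variable {I : Type*} [Fintype I] [DecidableEq I] {A : Matrix I I ℤ}
variable {g : Type*} [LieRing g] [LieAlgebra ℂ g]

/-! ### Joint eigenspaces -/

theorem weight_unique {V : Type*} [AddCommGroup V] [Module ℂ V] {ι : V →ₗ[ℂ] g}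
    {χ χ' : Module.Dual ℂ V} {x : g} (hx : x ∈ wtSpaceι ι χ) (hx' : x ∈ wtSpaceι ι χ')
    (h0 : x ≠ 0) : χ = χ' := by
  ext v
  have h := (hx v).symm.trans (hx' v)
  exact smul_left_injective ℂ h0 h

theorem wtSpaceι_independent {V : Type*} [AddCommGroup V] [Module ℂ V] (ι : V →ₗ[ℂ] g)
    (hι : ∀ v w, ⁅ι v, ι w⁆ = 0) : iSupIndep fun χ : Module.Dual ℂ V => wtSpaceι ι χ := by
  have h := Module.End.independent_iInf_maxGenEigenspace_of_forall_mapsTo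
    (fun v : V => LieAlgebra.ad ℂ g (ι v)) (fun v w φ =>
      Module.End.mapsTo_maxGenEigenspace_of_comm (LinearMap.ext fun x => by
        simp only [Module.End.mul_apply, LieAlgebra.ad_apply]
        rw [leibniz_lie, hι, zero_lie, zero_add]) φ)
  refine (h.comp (f := fun χ : Module.Dual ℂ V => (χ : V → ℂ)) DFunLike.coe_injective).mono ?_
  intro χ x hx
  simp only [Function.comp_apply, Submodule.mem_iInf]
  intro v
  refine Module.End.mem_maxGenEigenspace _ _ _ |>.2 ⟨1, ?_⟩
  simp [hx v]

theorem wtSpaceι_le_span {V : Type*} [AddCommGroup V] [Module ℂ V] (ι : V →ₗ[ℂ] g)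
    (hι : ∀ v w, ⁅ι v, ι w⁆ = 0) {s : Set g} (hs : Submodule.span ℂ s = ⊤)
    (hw : ∀ x ∈ s, ∃ μ, x ∈ wtSpaceι ι μ) (χ : Module.Dual ℂ V) :
    wtSpaceι ι χ ≤ Submodule.span ℂ (s ∩ wtSpaceι ι χ) := by
  intro x hx
  have htop : (⊤ : Submodule ℂ g) ≤
      Submodule.span ℂ (s ∩ wtSpaceι ι χ) ⊔ ⨆ μ, ⨆ (_ : μ ≠ χ), wtSpaceι ι μ := by
    rw [← hs, Submodule.span_le]
    intro y hy
    obtain ⟨μ, hμ⟩ := hw y hy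
    by_cases h : μ = χ
    · subst h
      exact Submodule.mem_sup_left (Submodule.subset_span ⟨hy, hμ⟩)
    · exact Submodule.mem_sup_right
        (Submodule.mem_iSup_of_mem μ (Submodule.mem_iSup_of_mem h hμ))
  obtain ⟨a, ha, b, hb, rfl⟩ := Submodule.mem_sup.1 (htop (Submodule.mem_top (x := x)))
  have ha' : a ∈ wtSpaceι ι χ := (Submodule.span_le.2 Set.inter_subset_right) ha
  have hb' : b ∈ wtSpaceι ι χ := by simpa using Submodule.sub_mem _ hx ha'
  have hb0 : b = 0 :=
    (Submodule.disjoint_def.1 (wtSpaceι_independent ι hι χ)) b hb' hb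
  simpa [hb0] using ha

/-! ### The triangular decomposition -/

/-- The Kac-Moody structure obtained by exchanging the roles of the positive and of the
negative Chevalley generators. -/
def KacMoodyAlgebra.swap (G : KacMoodyAlgebra A g) : KacMoodyAlgebra A g where
  H := G.H
  root i := -G.root i
  coroot i := -G.coroot i
  e := G.f
  f := G.e
  findimH := G.findimH
  finrankH := G.finrankH
  indepRoot := by
    convert G.indepRoot.units_smul (fun _ => (-1 : ℂˣ)) using 1
    funext i; simp
  indepCoroot := by
    convert G.indepCoroot.units_smul (fun _ => (-1 : ℂˣ)) using 1
    funext i; simp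
  pairing i j := by simpa using G.pairing i j
  abelian := G.abelian
  lie_e x i := by simpa using G.lie_f x i
  lie_f x i := by simpa using G.lie_e x i
  e_f i j := by
    rw [← lie_skew, G.e_f]
    by_cases h : i = j
    · subst h; simp
    · simp [h, Ne.symm h]
  serre_e := G.serre_f
  serre_f := G.serre_e
  generates := by rw [Set.union_right_comm]; exact G.generates
  weight_decomp := G.weight_decomp
  zero_weight := G.zero_weight

/-- The integral linear combination of the simple roots with the given coefficients. -/
def rootComb (G : KacMoodyAlgebra A g) : (I → ℤ) →+ Module.Dual ℂ G.H where
  toFun c := ∑ i, (c i : ℂ) • G.root i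
  map_zero' := by simp
  map_add' c c' := by simp [add_smul, Finset.sum_add_distrib]

theorem rootComb_apply (G : KacMoodyAlgebra A g) (c : I → ℤ) :
    rootComb G c = ∑ i, (c i : ℂ) • G.root i := rfl

theorem rootComb_single (G : KacMoodyAlgebra A g) (i : I) (n : ℤ) :
    rootComb G (Pi.single i n) = (n : ℂ) • G.root i := by
  rw [rootComb_apply, Finset.sum_eq_single i]
  · simp
  · intro j _ hj; simp [Pi.single_eq_of_ne hj]
  · simp

theorem rootComb_injective (G : KacMoodyAlgebra A g) : Function.Injective (rootComb G) := by
  intro c c' h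
  have := Fintype.linearIndependent_iff.1 G.indepRoot (fun i => (c i : ℂ) - c' i) (by
    simp only [sub_smul, Finset.sum_sub_distrib]
    exact sub_eq_zero.2 h)
  funext i
  exact_mod_cast sub_eq_zero.1 (this i)

theorem rootComb_swap (G : KacMoodyAlgebra A g) (c : I → ℤ) :
    rootComb G.swap c = rootComb G (-c) := by
  change ∑ i, (c i : ℂ) • -G.root i = _
  simp [rootComb_apply]

theorem rootComb_coroot (G : KacMoodyAlgebra A g) (c : I → ℤ) (i : I) :
    rootComb G c (G.coroot i) = ((∑ j, A i j * c j : ℤ) : ℂ) := by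
  simp [rootComb_apply, G.pairing, mul_comm]

theorem lie_mem_wtSpace (G : KacMoodyAlgebra A g) {χ χ' : Module.Dual ℂ G.H} {x y : g}
    (hx : x ∈ wtSpaceι G.H.subtype χ) (hy : y ∈ wtSpaceι G.H.subtype χ') :
    ⁅x, y⁆ ∈ wtSpaceι G.H.subtype (χ + χ') := by
  intro v
  rw [leibniz_lie, hx v, hy v, smul_lie, lie_smul, LinearMap.add_apply, add_smul]

theorem e_mem_wtSpace (G : KacMoodyAlgebra A g) (i : I) :
    G.e i ∈ wtSpaceι G.H.subtype (rootComb G (Pi.single i 1)) := by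
  intro v
  simpa [rootComb_single] using G.lie_e v i

theorem f_mem_wtSpace (G : KacMoodyAlgebra A g) (i : I) :
    G.f i ∈ wtSpaceι G.H.subtype (rootComb G (Pi.single i (-1))) := by
  intro v
  simpa [rootComb_single] using G.lie_f v i

/-- The iterated bracket of positive Chevalley generators along a word, with innermost
letter `k`. -/
def eWord (G : KacMoodyAlgebra A g) (k : I) (w : List I) : g :=
  w.foldr (fun i x => ⁅G.e i, x⁆) (G.e k)

@[simp] theorem eWord_nil (G : KacMoodyAlgebra A g) (k : I) : eWord G k [] = G.e k := rfl

@[simp] theorem eWord_cons (G : KacMoodyAlgebra A g) (k i : I) (w : List I) :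
    eWord G k (i :: w) = ⁅G.e i, eWord G k w⁆ := rfl

theorem eWord_mem_wtSpace (G : KacMoodyAlgebra A g) (k : I) (w : List I) :
    eWord G k w ∈ wtSpaceι G.H.subtype (rootComb G (letterCount (k :: w))) := by
  induction w with
  | nil =>
    have h : letterCount [k] = Pi.single k 1 := by
      rw [letterCount_cons]; funext j; simp [letterCount]
    rw [h]; exact e_mem_wtSpace G k
  | cons i w ih =>
    have h : letterCount (k :: i :: w) = Pi.single i 1 + letterCount (k :: w) := by
      simp only [letterCount_cons]; abel
    rw [h, map_add]
    exact lie_mem_wtSpace G (e_mem_wtSpace G i) ih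

/-- The span of the iterated brackets of positive Chevalley generators. -/
def eSpan (G : KacMoodyAlgebra A g) : Submodule ℂ g :=
  Submodule.span ℂ (Set.range fun p : I × List I => eWord G p.1 p.2)

theorem eWord_mem_eSpan (G : KacMoodyAlgebra A g) (k : I) (w : List I) :
    eWord G k w ∈ eSpan G := Submodule.subset_span ⟨(k, w), rfl⟩

theorem lie_e_mem_eSpan (G : KacMoodyAlgebra A g) (i : I) {x : g} (hx : x ∈ G.H ⊔ eSpan G) :
    ⁅G.e i, x⁆ ∈ eSpan G := by
  have : G.H ⊔ eSpan G ≤ (eSpan G).comap (LieAlgebra.ad ℂ g (G.e i)) := by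
    refine sup_le ?_ (Submodule.span_le.2 ?_)
    · intro h hh
      rw [Submodule.mem_comap, LieAlgebra.ad_apply, ← lie_skew,
        G.lie_e ⟨h, hh⟩ i]
      exact Submodule.neg_mem _ (Submodule.smul_mem _ _ (eWord_mem_eSpan G i []))
    · rintro _ ⟨⟨k, w⟩, rfl⟩
      exact eWord_mem_eSpan G k (i :: w)
  exact this hx

theorem lie_e_fWord_mem (G : KacMoodyAlgebra A g) (i k : I) (w : List I) :
    ⁅G.e i, eWord G.swap k w⁆ ∈ G.H ⊔ eSpan G.swap := by
  induction w with
  | nil =>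
    change ⁅G.e i, G.f k⁆ ∈ _
    rw [G.e_f]
    split_ifs
    · exact Submodule.mem_sup_left (G.coroot i).2
    · exact Submodule.zero_mem _
  | cons j w ih =>
    change ⁅G.e i, ⁅G.f j, eWord G.swap k w⁆⁆ ∈ _
    rw [leibniz_lie]
    refine Submodule.mem_sup_right (Submodule.add_mem _ ?_ (lie_e_mem_eSpan G.swap j ih))
    rw [G.e_f]
    split_ifs
    · rw [show ⁅(G.coroot i : g), eWord G.swap k w⁆ = _ from
        eWord_mem_wtSpace G.swap k w (G.coroot i)]
      exact Submodule.smul_mem _ _ (eWord_mem_eSpan G.swap k w)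
    · rw [zero_lie]; exact Submodule.zero_mem _

theorem lie_e_mem_triangular (G : KacMoodyAlgebra A g) (i : I) {x : g}
    (hx : x ∈ G.H ⊔ eSpan G ⊔ eSpan G.swap) : ⁅G.e i, x⁆ ∈ G.H ⊔ eSpan G ⊔ eSpan G.swap := by
  obtain ⟨y, hy, z, hz, rfl⟩ := Submodule.mem_sup.1 hx
  rw [lie_add]
  refine Submodule.add_mem _ (Submodule.mem_sup_left
    (Submodule.mem_sup_right (lie_e_mem_eSpan G i hy))) ?_
  have hle : eSpan G.swap ≤
      (G.H ⊔ eSpan G.swap).comap (LieAlgebra.ad ℂ g (G.e i)) := by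
    refine Submodule.span_le.2 ?_
    rintro _ ⟨⟨k, w⟩, rfl⟩
    exact lie_e_fWord_mem G i k w
  exact (sup_le_sup_right le_sup_left _ : _ ≤ G.H ⊔ eSpan G ⊔ eSpan G.swap) (hle hz)

theorem lie_H_mem_eSpan (G : KacMoodyAlgebra A g) (h : G.H) {x : g} (hx : x ∈ eSpan G) :
    ⁅(h : g), x⁆ ∈ eSpan G := by
  have hle : eSpan G ≤ (eSpan G).comap (LieAlgebra.ad ℂ g (h : g)) := by
    refine Submodule.span_le.2 ?_
    rintro _ ⟨⟨k, w⟩, rfl⟩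
    change ⁅(h : g), eWord G k w⁆ ∈ eSpan G
    rw [show ⁅(h : g), eWord G k w⁆ = _ from eWord_mem_wtSpace G k w h]
    exact Submodule.smul_mem _ _ (eWord_mem_eSpan G k w)
  exact hle hx

theorem triangular (G : KacMoodyAlgebra A g) : G.H ⊔ eSpan G ⊔ eSpan G.swap = ⊤ := by
  set T := G.H ⊔ eSpan G ⊔ eSpan G.swap with hT
  have hgen : ∀ x ∈ (G.H : Set g) ∪ Set.range G.e ∪ Set.range G.f,
      x ∈ T ∧ ∀ t ∈ T, ⁅x, t⁆ ∈ T := by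
    rintro x ((hx | ⟨i, rfl⟩) | ⟨i, rfl⟩)
    · refine ⟨Submodule.mem_sup_left (Submodule.mem_sup_left hx), fun t ht => ?_⟩
      obtain ⟨y, hy, z, hz, rfl⟩ := Submodule.mem_sup.1 ht
      obtain ⟨h, hh, y', hy', rfl⟩ := Submodule.mem_sup.1 hy
      rw [lie_add, lie_add, G.abelian ⟨x, hx⟩ ⟨h, hh⟩, zero_add]
      exact Submodule.add_mem _
        (Submodule.mem_sup_left (Submodule.mem_sup_right (lie_H_mem_eSpan G ⟨x, hx⟩ hy')))
        (Submodule.mem_sup_right (lie_H_mem_eSpan G.swap ⟨x, hx⟩ hz))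
    · exact ⟨Submodule.mem_sup_left (Submodule.mem_sup_right (eWord_mem_eSpan G i [])),
        fun t ht => lie_e_mem_triangular G i ht⟩
    · refine ⟨Submodule.mem_sup_right (eWord_mem_eSpan G.swap i []), fun t ht => ?_⟩
      have hswap : T = G.swap.H ⊔ eSpan G.swap ⊔ eSpan G.swap.swap := sup_right_comm _ _ _
      rw [hswap] at ht ⊢
      exact lie_e_mem_triangular G.swap i ht
  rw [eq_top_iff]
  intro x _
  have hx : x ∈ LieSubalgebra.lieSpan ℂ g
      ((G.H : Set g) ∪ Set.range G.e ∪ Set.range G.f) := by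
    rw [G.generates]; exact LieSubalgebra.mem_top x
  refine (LieSubalgebra.lieSpan_induction (p := fun x _ => x ∈ T ∧ ∀ t ∈ T, ⁅x, t⁆ ∈ T)
    ℂ ?_ ?_ ?_ ?_ ?_ hx).1
  · exact hgen
  · exact ⟨Submodule.zero_mem _, fun t _ => by rw [zero_lie]; exact Submodule.zero_mem _⟩
  · intro x y _ _ hx hy
    refine ⟨Submodule.add_mem _ hx.1 hy.1, fun t ht => ?_⟩
    rw [add_lie]
    exact Submodule.add_mem _ (hx.2 t ht) (hy.2 t ht)
  · intro a x _ hx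
    refine ⟨Submodule.smul_mem _ _ hx.1, fun t ht => ?_⟩
    rw [smul_lie]
    exact Submodule.smul_mem _ _ (hx.2 t ht)
  · intro x y _ _ hx hy
    refine ⟨hx.2 y hy.1, fun t ht => ?_⟩
    rw [lie_lie]
    exact Submodule.sub_mem _ (hx.2 _ (hy.2 t ht)) (hy.2 _ (hx.2 t ht))

/-- The Cartan subalgebra together with all iterated brackets of positive, respectively
negative, Chevalley generators. -/
def triangularSet (G : KacMoodyAlgebra A g) : Set g :=
  (G.H : Set g) ∪ (Set.range fun p : I × List I => eWord G p.1 p.2) ∪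
    Set.range fun p : I × List I => eWord G.swap p.1 p.2

theorem span_triangularSet (G : KacMoodyAlgebra A g) :
    Submodule.span ℂ (triangularSet G) = ⊤ := by
  rw [triangularSet, Submodule.span_union, Submodule.span_union, Submodule.span_eq]
  exact triangular G

theorem H_le_wtSpace_zero (G : KacMoodyAlgebra A g) {x : g} (hx : x ∈ G.H) :
    x ∈ wtSpaceι G.H.subtype (rootComb G 0) := by
  rw [map_zero, G.zero_weight]; exact hx

theorem fWord_mem_wtSpace (G : KacMoodyAlgebra A g) (k : I) (w : List I) :
    eWord G.swap k w ∈ wtSpaceι G.H.subtype (rootComb G (-letterCount (k :: w))) := by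
  have h := eWord_mem_wtSpace G.swap k w
  rw [rootComb_swap] at h
  exact h

theorem exists_rootComb_of_mem_triangularSet (G : KacMoodyAlgebra A g) {x : g}
    (hx : x ∈ triangularSet G) : ∃ c, x ∈ wtSpaceι G.H.subtype (rootComb G c) := by
  rcases hx with (hx | ⟨⟨k, w⟩, rfl⟩) | ⟨⟨k, w⟩, rfl⟩
  · exact ⟨0, H_le_wtSpace_zero G hx⟩
  · exact ⟨_, eWord_mem_wtSpace G k w⟩
  · exact ⟨_, fWord_mem_wtSpace G k w⟩

/-- The integral linear combinations of the simple roots which are weights of `g`. -/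
def IsWt (G : KacMoodyAlgebra A g) (c : I → ℤ) : Prop :=
  ∃ x ∈ wtSpaceι G.H.subtype (rootComb G c), x ≠ 0

theorem IsWt.cases {G : KacMoodyAlgebra A g} {c : I → ℤ} (h : IsWt G c) :
    c = 0 ∨ (∃ k w, eWord G k w ≠ 0 ∧ c = letterCount (k :: w)) ∨
      ∃ k w, eWord G.swap k w ≠ 0 ∧ c = -letterCount (k :: w) := by
  obtain ⟨x, hx, hx0⟩ := h
  have hspan := wtSpaceι_le_span G.H.subtype G.abelian (span_triangularSet G) (fun y hy => by
    obtain ⟨c, hc⟩ := exists_rootComb_of_mem_triangularSet G hy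
    exact ⟨_, hc⟩) (rootComb G c) hx
  obtain ⟨y, ⟨hyT, hyc⟩, hy0⟩ :
      ∃ y ∈ triangularSet G ∩ wtSpaceι G.H.subtype (rootComb G c), y ≠ 0 := by
    by_contra! hcon
    rw [(Submodule.span_eq_bot.2 hcon :
      Submodule.span ℂ (triangularSet G ∩ wtSpaceι G.H.subtype (rootComb G c)) = ⊥)] at hspan
    exact hx0 hspan
  have key : ∀ c', y ∈ wtSpaceι G.H.subtype (rootComb G c') → c = c' := fun c' h' =>
    rootComb_injective G (weight_unique hyc h' hy0)
  rcases hyT with (hy | ⟨⟨k, w⟩, rfl⟩) | ⟨⟨k, w⟩, rfl⟩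
  · exact Or.inl (key _ (H_le_wtSpace_zero G hy))
  · exact Or.inr (Or.inl ⟨k, w, hy0, key _ (eWord_mem_wtSpace G k w)⟩)
  · exact Or.inr (Or.inr ⟨k, w, hy0, key _ (fWord_mem_wtSpace G k w)⟩)

theorem IsWt.nonneg_or_nonpos {G : KacMoodyAlgebra A g} {c : I → ℤ} (h : IsWt G c) :
    0 ≤ c ∨ c ≤ 0 := by
  rcases h.cases with rfl | ⟨k, w, -, rfl⟩ | ⟨k, w, -, rfl⟩
  · exact Or.inl le_rfl
  · exact Or.inl (letterCount_nonneg _)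
  · exact Or.inr (neg_nonpos.2 (letterCount_nonneg _))

theorem eWord_replicate (G : KacMoodyAlgebra A g) (i : I) (n : ℕ) :
    eWord G i (List.replicate (n + 1) i) = 0 := by
  induction n with
  | zero => simp
  | succ n ih => rw [List.replicate_succ, eWord_cons, ih, lie_zero]

theorem IsWt.eq_one_of_single {G : KacMoodyAlgebra A g} {i : I} {n : ℤ} (hn : 0 < n)
    (h : IsWt G (Pi.single i n)) : n = 1 := by
  rcases h.cases with h | ⟨k, w, h0, h⟩ | ⟨k, w, -, h⟩
  · have := congrFun h i
    simp at this; omega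
  · have hmem : ∀ j ∈ k :: w, j = i := by
      intro j hj
      by_contra hji
      have h1 := congrFun h j
      rw [Pi.single_eq_of_ne hji] at h1
      have h2 := List.count_pos_iff.2 hj
      simp only [letterCount] at h1
      omega
    have hk : k = i := hmem k (by simp)
    subst hk
    have hw : w = List.replicate w.length k :=
      List.eq_replicate_iff.2 ⟨rfl, fun b hb => hmem b (by simp [hb])⟩
    cases hl : w.length with
    | zero =>
      rw [List.length_eq_zero_iff] at hl
      subst hl
      have := congrFun h k
      simpa [letterCount] using this
    | succ m =>
      rw [hl] at hw
      exact absurd (hw ▸ eWord_replicate G k m) h0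
  · have h1 := congrFun h i
    have h2 := letterCount_nonneg (k :: w) i
    simp at h1 h2; omega

/-! ### Local nilpotency and reflections of weights -/

theorem e_locally_nilpotent (G : KacMoodyAlgebra A g) (i : I) (x : g) :
    ∃ n : ℕ, ((LieAlgebra.ad ℂ g (G.e i)) ^ n) x = 0 := by
  have hle : LieSubalgebra.lieSpan ℂ g ((G.H : Set g) ∪ Set.range G.e ∪ Set.range G.f) ≤
      LieSubalgebra.engel ℂ (G.e i) := by
    rw [LieSubalgebra.lieSpan_le]
    have hH : ∀ h : G.H, ⁅G.e i, ⁅G.e i, (h : g)⁆⁆ = 0 := fun h => by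
      rw [← lie_skew _ (h : g), G.lie_e, lie_neg, lie_smul, lie_self, smul_zero, neg_zero]
    rintro x ((hx | ⟨j, rfl⟩) | ⟨j, rfl⟩) <;>
      rw [SetLike.mem_coe, LieSubalgebra.mem_engel_iff]
    · exact ⟨2, by simpa [pow_succ] using hH ⟨x, hx⟩⟩
    · by_cases hij : i = j
      · subst hij
        exact ⟨1, by simp⟩
      · exact ⟨_, G.serre_e i j hij⟩
    · refine ⟨3, ?_⟩
      simp only [pow_succ, pow_zero, one_mul, Module.End.mul_apply, LieAlgebra.ad_apply, G.e_f]
      split_ifs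
      · exact hH _
      · simp
  rw [G.generates] at hle
  exact (LieSubalgebra.mem_engel_iff ℂ _ _).1 (hle (LieSubalgebra.mem_top x))

theorem ad_pow_mem_wtSpace (G : KacMoodyAlgebra A g) {c c' : I → ℤ} {x y : g}
    (hx : x ∈ wtSpaceι G.H.subtype (rootComb G c))
    (hy : y ∈ wtSpaceι G.H.subtype (rootComb G c')) (n : ℕ) :
    ((LieAlgebra.ad ℂ g x) ^ n) y ∈ wtSpaceι G.H.subtype (rootComb G (c' + n • c)) := by
  induction n with
  | zero => simpa using hy
  | succ n ih =>
    rw [pow_succ', Module.End.mul_apply, LieAlgebra.ad_apply]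
    have := lie_mem_wtSpace G hx ih
    rw [← map_add] at this
    convert this using 3
    rw [succ_nsmul]; abel

theorem sl2Triple (G : KacMoodyAlgebra A g) (hA : ∀ i, A i i = 2) (i : I) :
    IsSl2Triple (G.coroot i : g) (G.e i) (G.f i) where
  h_ne_zero := fun h => by
    have h0 : G.coroot i = 0 := by exact_mod_cast h
    have := G.pairing i i
    rw [h0, map_zero, hA] at this
    norm_num at this
  lie_e_f := by rw [G.e_f, if_pos rfl]
  lie_h_e_nsmul := by rw [G.lie_e, G.pairing, hA, ← Nat.cast_smul_eq_nsmul ℂ]; norm_num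
  lie_h_f_nsmul := by
    rw [G.lie_f, G.pairing, hA, ← Nat.cast_smul_eq_nsmul ℂ, neg_smul]; norm_num

theorem IsWt.reflect {G : KacMoodyAlgebra A g} (hA : ∀ i, A i i = 2) {c : I → ℤ}
    (h : IsWt G c) (i : I) (hn : 0 ≤ ∑ j, A i j * c j) :
    IsWt G (c - Pi.single i (∑ j, A i j * c j)) := by
  obtain ⟨x, hx, hx0⟩ := h
  obtain ⟨n, hn'⟩ := Int.eq_ofNat_of_zero_le hn
  obtain ⟨p, hp, hp'⟩ : ∃ p : ℕ, ((LieAlgebra.ad ℂ g (G.e i)) ^ p) x ≠ 0 ∧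
      ((LieAlgebra.ad ℂ g (G.e i)) ^ (p + 1)) x = 0 := by
    by_contra! hcon
    obtain ⟨m, hm⟩ := e_locally_nilpotent G i x
    have : ∀ p : ℕ, ((LieAlgebra.ad ℂ g (G.e i)) ^ p) x ≠ 0 := fun p => by
      induction p with
      | zero => simpa using hx0
      | succ p ih => exact hcon p ih
    exact this m hm
  set y := ((LieAlgebra.ad ℂ g (G.e i)) ^ p) x with hy
  have hyw := ad_pow_mem_wtSpace G (e_mem_wtSpace G i) hx p
  rw [← hy] at hyw
  have P : (sl2Triple G hA i).HasPrimitiveVectorWith y ((n + 2 * p : ℕ) : ℂ) :=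
    { ne_zero := hp
      lie_h := by
        rw [show ⁅(G.coroot i : g), y⁆ = _ from hyw (G.coroot i), map_add, map_nsmul,
          LinearMap.add_apply, rootComb_coroot, hn', rootComb_single]
        simp [G.pairing, hA, mul_comm]
      lie_e := by
        rw [pow_succ', Module.End.mul_apply] at hp'
        exact hp' }
  have hf : ∀ k ≤ n + 2 * p, ((LieAlgebra.ad ℂ g (G.f i)) ^ k) y ≠ 0 := by
    intro k
    induction k with
    | zero => intro _; simpa using hp
    | succ k ih =>
      intro hk h0
      have := P.lie_e_pow_succ_toEnd_f k
      rw [show (LieModule.toEnd ℂ g g (G.f i) ^ (k + 1)) y = 0 from h0, lie_zero, eq_comm,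
        smul_eq_zero_iff_left
          (show (LieModule.toEnd ℂ g g (G.f i) ^ k) y ≠ 0 from ih (by omega)), mul_eq_zero, sub_eq_zero] at this
      rcases this with h | h
      · exact Nat.cast_add_one_ne_zero k h
      · have := Nat.cast_injective h
        omega
  refine ⟨_, ?_, hf (n + p) (by omega)⟩
  have hw := ad_pow_mem_wtSpace G (f_mem_wtSpace G i) hyw (n + p)
  convert hw using 3
  rw [hn']
  funext j
  by_cases hj : j = i
  · subst hj; simp; ring
  · simp [Pi.single_eq_of_ne hj]

/-! ### The invariant quadratic form on the root lattice -/

/-- The quadratic form on the root lattice attached to a symmetrizer `d` of `A`. -/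
def rootForm (A : Matrix I I ℤ) (d : I → ℚ) (c : I → ℤ) : ℚ :=
  ∑ i, ∑ j, d i * A i j * (c i * c j)

theorem rootForm_reflect {d : I → ℚ} (hA : ∀ i, A i i = 2)
    (hd : ∀ i j, d i * (A i j : ℚ) = d j * (A j i : ℚ)) (c : I → ℤ) (i : I) :
    rootForm A d (c - Pi.single i (∑ j, A i j * c j)) = rootForm A d c := by
  set n := ∑ j, A i j * c j with hn
  have hnQ : ∑ j, (A i j : ℚ) * c j = n := by rw [hn]; push_cast; rfl
  have hs : ∀ j, (((Pi.single i n : I → ℤ) j : ℤ) : ℚ) = if j = i then (n : ℚ) else 0 := by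
    intro j
    by_cases hj : j = i
    · subst hj; simp
    · simp [hj]
  have h1 : ∑ j, ∑ k, d j * A j k * (c j * (if k = i then (n : ℚ) else 0)) = d i * n * n := by
    simp only [mul_ite, mul_zero, Finset.sum_ite_eq', Finset.mem_univ, if_true]
    rw [show d i * n * n = d i * n * ∑ j, (A i j : ℚ) * c j by rw [hnQ], Finset.mul_sum]
    refine Finset.sum_congr rfl fun j _ => ?_
    rw [hd j i]; ring
  have h2 : ∑ j, ∑ k, d j * A j k * ((if j = i then (n : ℚ) else 0) * c k) = d i * n * n := by
    rw [Finset.sum_eq_single i]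
    · simp only [if_true]
      rw [show d i * n * n = d i * n * ∑ j, (A i j : ℚ) * c j by rw [hnQ], Finset.mul_sum]
      refine Finset.sum_congr rfl fun j _ => by ring
    · intro j _ hj; simp [hj]
    · simp
  have h3 : ∑ j, ∑ k, d j * A j k * ((if j = i then (n : ℚ) else 0) *
      (if k = i then (n : ℚ) else 0)) = 2 * (d i * n * n) := by
    rw [Finset.sum_eq_single i]
    · simp [hA]; ring
    · intro j _ hj; simp [hj]
    · simp
  have h4 : rootForm A d (c - Pi.single i n) = rootForm A d c
      - ∑ j, ∑ k, d j * A j k * (c j * (if k = i then (n : ℚ) else 0))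
      - ∑ j, ∑ k, d j * A j k * ((if j = i then (n : ℚ) else 0) * c k)
      + ∑ j, ∑ k, d j * A j k * ((if j = i then (n : ℚ) else 0) *
      (if k = i then (n : ℚ) else 0)) := by
    simp only [rootForm, ← Finset.sum_sub_distrib, ← Finset.sum_add_distrib]
    refine Finset.sum_congr rfl fun j _ => Finset.sum_congr rfl fun k _ => ?_
    rw [Pi.sub_apply, Pi.sub_apply, Int.cast_sub, Int.cast_sub, hs, hs]
    ring
  rw [h4, h1, h2, h3]; ring

theorem rootForm_single {d : I → ℚ} (hA : ∀ i, A i i = 2) (i : I) :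
    rootForm A d (Pi.single i 1) = 2 * d i := by
  rw [rootForm, Finset.sum_eq_single i, Finset.sum_eq_single i]
  · simp [hA]; ring
  · intro j _ hj; simp [hj]
  · simp
  · intro j _ hj; simp [hj]
  · simp

theorem rootForm_le_of_antidominant (hGCM : IsGCM A) {d : I → ℚ} (hd : ∀ i, 0 < d i)
    {S : Set I} {c : I → ℤ} (hc : 0 ≤ c) (hanti : ∀ i ∈ S, ∑ j, A i j * c j ≤ 0) :
    rootForm A d c ≤ rootForm A d (Sᶜ.indicator c) := by
  have hsum : ∀ x : I → ℤ, rootForm A d x = ∑ i, d i * ((x i * ∑ j, A i j * x j : ℤ) : ℚ) := by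
    intro x
    rw [rootForm]
    refine Finset.sum_congr rfl fun i _ => ?_
    push_cast
    rw [Finset.mul_sum, Finset.mul_sum]
    exact Finset.sum_congr rfl fun j _ => by ring
  rw [hsum, hsum]
  refine Finset.sum_le_sum fun i _ => mul_le_mul_of_nonneg_left ?_ (hd i).le
  rw [Int.cast_le]
  by_cases hi : i ∈ S
  · rw [Set.indicator_of_notMem (by simpa using hi), zero_mul]
    exact mul_nonpos_of_nonneg_of_nonpos (hc i) (hanti i hi)
  · rw [Set.indicator_of_mem (show i ∈ Sᶜ from hi)]
    refine mul_le_mul_of_nonneg_left (Finset.sum_le_sum fun j _ => ?_) (hc i)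
    by_cases hj : j ∈ S
    · rw [Set.indicator_of_notMem (by simpa using hj), mul_zero]
      exact mul_nonpos_of_nonpos_of_nonneg
        (hGCM.2.1 i j fun h => hi (h ▸ hj)) (hc j)
    · rw [Set.indicator_of_mem (show j ∈ Sᶜ from hj)]

theorem IsWt.rootForm_le {G : KacMoodyAlgebra A g} (hGCM : IsGCM A) {d : I → ℚ}
    (hd : ∀ i, 0 < d i) (hsymm : ∀ i j, d i * (A i j : ℚ) = d j * (A j i : ℚ)) (S : Set I)
    {c : I → ℤ} (hc : 0 ≤ c) (h : IsWt G c) :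
    rootForm A d c ≤ rootForm A d (Sᶜ.indicator c) + 2 * ∑ i, d i := by
  have hD : 0 ≤ ∑ i, d i := Finset.sum_nonneg fun i _ => (hd i).le
  induction hN : (∑ i, c i).toNat using Nat.strong_induction_on generalizing c with
  | _ N ih =>
  by_cases hanti : ∀ i ∈ S, ∑ j, A i j * c j ≤ 0
  · have := rootForm_le_of_antidominant hGCM hd hc hanti
    linarith
  · push Not at hanti
    obtain ⟨i, hi, hn⟩ := hanti
    have hrefl := rootForm_reflect hGCM.1 hsymm c i
    have hwt := h.reflect hGCM.1 i hn.le
    set n := ∑ j, A i j * c j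
    rcases hwt.nonneg_or_nonpos with hpos | hneg
    · have hsum : ∑ j, (c - Pi.single i n : I → ℤ) j = ∑ j, c j - n := by
        simp [Finset.sum_sub_distrib]
      have h0 : 0 ≤ ∑ j, (c - Pi.single i n : I → ℤ) j := Finset.sum_nonneg fun j _ => hpos j
      have key := ih _ (by omega) hpos hwt rfl
      rw [hrefl] at key
      convert key using 3
      funext j
      by_cases hj : j ∈ S
      · rw [Set.indicator_of_notMem (by simpa using hj),
          Set.indicator_of_notMem (by simpa using hj)]
      · have hji : j ≠ i := fun h => hj (h ▸ hi)
        rw [Set.indicator_of_mem (show j ∈ Sᶜ from hj),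
          Set.indicator_of_mem (show j ∈ Sᶜ from hj)]
        simp [hji]
    · have hci : c = Pi.single i (c i) := by
        funext j
        by_cases hj : j = i
        · subst hj; simp
        · have h1 := hneg j
          have h2 := hc j
          simp [hj] at h1 h2 ⊢
          omega
      have hpos : 0 < c i := by
        refine lt_of_le_of_ne (hc i) fun h0 => ?_
        rw [← h0, Pi.single_zero] at hci
        simp [n, hci] at hn
      have hone : c i = 1 := IsWt.eq_one_of_single hpos (hci ▸ h)
      rw [hone] at hci
      have hind : Sᶜ.indicator c = 0 := by
        rw [hci]
        funext j
        by_cases hj : j = i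
        · subst hj; rw [Set.indicator_of_notMem (by simpa using hi)]; rfl
        · simp [Set.indicator, hj]
      rw [hind, hci, rootForm_single hGCM.1]
      have := Finset.single_le_sum (fun j _ => (hd j).le) (Finset.mem_univ i)
      simp only [rootForm, Pi.zero_apply]
      simp
      linarith

theorem exists_pos_vector_of_finiteType {S : Set I} (hS : IsFiniteType (restrictM A S)) :
    ∃ u : I → ℚ, (∀ i ∈ S, 0 < u i) ∧ (∀ i ∉ S, u i = 0) ∧
      ∀ i ∈ S, 0 < ∑ j, (A i j : ℚ) * u j := by
  obtain ⟨u, hu, hAu⟩ := hS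
  refine ⟨fun i => if h : i ∈ S then u ⟨i, h⟩ else 0, fun i hi => by simpa [hi] using hu _,
    fun i hi => by simp [hi], fun i hi => ?_⟩
  have h := hAu ⟨i, hi⟩
  rw [finsum_eq_sum_of_fintype] at h
  refine h.trans_le (le_of_eq ?_)
  rw [← Finset.sum_subset (Finset.subset_univ S.toFinset) (fun j _ hj => by
    simp [Set.mem_toFinset.not.1 hj]), Finset.sum_subtype S.toFinset (p := (· ∈ S)) (by simp)]
  exact Finset.sum_congr rfl fun j _ => by simp [restrictM]

theorem form_lower_bound (hGCM : IsGCM A) {d : I → ℚ} (hd : ∀ i, 0 < d i)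
    (hsymm : ∀ i j, d i * (A i j : ℚ) = d j * (A j i : ℚ)) {u y : I → ℚ}
    (hu : ∀ i, 0 ≤ u i) (hy : ∀ i, u i = 0 → y i = 0) :
    ∑ i, d i * (∑ j, (A i j : ℚ) * u j) / u i * y i ^ 2 ≤
      ∑ i, ∑ j, d i * A i j * (y i * y j) := by
  set x : I → ℚ := fun i => y i / u i
  have hyx : ∀ i, y i = u i * x i := fun i => by
    by_cases h : u i = 0
    · rw [hy i h, h, zero_mul]
    · simp only [x]; field_simp
  have h1 : ∑ i, ∑ j, d i * A i j * (u i * u j) * ((x i ^ 2 + x j ^ 2) / 2) ≤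
      ∑ i, ∑ j, d i * A i j * (y i * y j) := by
    refine Finset.sum_le_sum fun i _ => Finset.sum_le_sum fun j _ => ?_
    rw [hyx i, hyx j]
    by_cases hij : i = j
    · subst hij; exact le_of_eq (by ring)
    · have hA : (A i j : ℚ) ≤ 0 := by exact_mod_cast hGCM.2.1 i j hij
      have h2 : 0 ≤ d i * (-(A i j : ℚ)) * (u i * u j) * (x i - x j) ^ 2 :=
        mul_nonneg (mul_nonneg (mul_nonneg (hd i).le (by linarith))
          (mul_nonneg (hu i) (hu j))) (sq_nonneg _)
      linarith
  have h2 : ∑ i, ∑ j, d i * A i j * (u i * u j) * x j ^ 2 =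
      ∑ i, ∑ j, d i * A i j * (u i * u j) * x i ^ 2 := by
    rw [Finset.sum_comm]
    refine Finset.sum_congr rfl fun i _ => Finset.sum_congr rfl fun j _ => ?_
    rw [hsymm j i]; ring
  have h3 : ∑ i, ∑ j, d i * A i j * (u i * u j) * ((x i ^ 2 + x j ^ 2) / 2) =
      ∑ i, ∑ j, d i * A i j * (u i * u j) * x i ^ 2 := by
    have : ∀ i j, d i * A i j * (u i * u j) * ((x i ^ 2 + x j ^ 2) / 2) =
        (d i * A i j * (u i * u j) * x i ^ 2) / 2 + (d i * A i j * (u i * u j) * x j ^ 2) / 2 :=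
      fun i j => by ring
    simp only [this, Finset.sum_add_distrib, ← Finset.sum_div]
    rw [h2]; ring
  refine le_trans (le_of_eq ?_) (h3 ▸ h1)
  refine Finset.sum_congr rfl fun i _ => ?_
  have h4 : ∑ j, d i * A i j * (u i * u j) * x i ^ 2 =
      d i * u i * x i ^ 2 * ∑ j, (A i j : ℚ) * u j := by
    rw [Finset.mul_sum]
    exact Finset.sum_congr rfl fun j _ => by ring
  rw [h4, hyx i]
  by_cases h : u i = 0
  · simp [h]
  · field_simp

theorem finite_of_rootForm_le (hGCM : IsGCM A) {d : I → ℚ} (hd : ∀ i, 0 < d i)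
    (hsymm : ∀ i j, d i * (A i j : ℚ) = d j * (A j i : ℚ)) {S : Set I}
    (hS : IsFiniteType (restrictM A S)) (o : I → ℤ) (M : ℚ) :
    {c : I → ℤ | (∀ i ∉ S, c i = o i) ∧ rootForm A d c ≤ M}.Finite := by
  obtain ⟨u, hu, hu0, hAu⟩ := exists_pos_vector_of_finiteType hS
  set a : I → ℚ := fun i => d i * (∑ j, (A i j : ℚ) * u j) / u i with ha
  have ha0 : ∀ i ∈ S, 0 < a i := fun i hi => div_pos (mul_pos (hd i) (hAu i hi)) (hu i hi)
  set p : I → ℚ := fun i => if i ∈ S then 0 else o i with hp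
  set b : I → ℚ := fun i => 2 * d i * ∑ j, (A i j : ℚ) * p j with hb
  set K : ℚ := M - ∑ i, ∑ j, d i * A i j * (p i * p j) + ∑ i, b i ^ 2 / (4 * a i)
  set N : I → ℤ := fun i => if i ∈ S then ⌈K / a i + 1 + |b i / (2 * a i)|⌉ else |o i| with hN
  refine (Set.finite_Icc (-N) N).subset ?_
  rintro c ⟨hco, hcM⟩
  set y : I → ℚ := fun i => if i ∈ S then c i else 0 with hy
  have hcpy : ∀ i, (c i : ℚ) = p i + y i := fun i => by
    by_cases hi : i ∈ S
    · simp [hp, hy, hi]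
    · simp [hp, hy, hi, hco i hi]
  have hlow := form_lower_bound hGCM hd hsymm (u := u) (y := y)
    (fun i => by
      by_cases hi : i ∈ S
      · exact (hu i hi).le
      · exact (hu0 i hi).ge)
    (fun i hi => by
      by_cases h : i ∈ S
      · exact absurd hi (hu i h).ne'
      · simp [hy, h])
  have hcross : ∑ i, ∑ j, d i * A i j * (p i * y j) = ∑ i, ∑ j, d i * A i j * (y i * p j) := by
    rw [Finset.sum_comm]
    refine Finset.sum_congr rfl fun i _ => Finset.sum_congr rfl fun j _ => ?_
    rw [hsymm j i]; ring
  have hbsum : ∑ i, b i * y i = 2 * ∑ i, ∑ j, d i * A i j * (y i * p j) := by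
    simp only [hb, Finset.mul_sum, Finset.sum_mul]
    exact Finset.sum_congr rfl fun i _ => Finset.sum_congr rfl fun j _ => by ring
  have hexp : rootForm A d c = ∑ i, ∑ j, d i * A i j * (p i * p j) +
      ∑ i, ∑ j, d i * A i j * (p i * y j) + ∑ i, ∑ j, d i * A i j * (y i * p j) +
      ∑ i, ∑ j, d i * A i j * (y i * y j) := by
    simp only [rootForm, ← Finset.sum_add_distrib]
    refine Finset.sum_congr rfl fun i _ => Finset.sum_congr rfl fun j _ => ?_
    rw [hcpy i, hcpy j]; ring
  have hterm : ∀ i, 0 ≤ a i * y i ^ 2 + b i * y i + b i ^ 2 / (4 * a i) := fun i => by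
    by_cases hi : i ∈ S
    · have h := ha0 i hi
      have : a i * y i ^ 2 + b i * y i + b i ^ 2 / (4 * a i) =
          a i * (y i + b i / (2 * a i)) ^ 2 := by field_simp; ring
      rw [this]
      exact mul_nonneg h.le (sq_nonneg _)
    · simp [hy, ha, hi, hu0 i hi]
  have hsumK : ∑ i, (a i * y i ^ 2 + b i * y i + b i ^ 2 / (4 * a i)) ≤ K := by
    simp only [Finset.sum_add_distrib, hbsum]
    simp only [K]
    linarith
  have habs : ∀ i, |c i| ≤ N i := fun i => by
    by_cases hi : i ∈ S
    · have h := ha0 i hi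
      have hK := (Finset.single_le_sum (fun j _ => hterm j) (Finset.mem_univ i)).trans hsumK
      have hsq : a i * y i ^ 2 + b i * y i + b i ^ 2 / (4 * a i) =
          a i * (y i + b i / (2 * a i)) ^ 2 := by field_simp; ring
      rw [hsq] at hK
      have hyi : y i = c i := by simp [hy, hi]
      rw [hyi] at hK
      set e := b i / (2 * a i)
      have h1 : ((c i : ℚ) + e) ^ 2 ≤ K / a i := by
        rw [le_div_iff₀ h]; linarith
      have h2 : |(c i : ℚ) + e| ≤ K / a i + 1 := by
        have := sq_abs ((c i : ℚ) + e)
        nlinarith [sq_nonneg (|(c i : ℚ) + e| - 1), abs_nonneg ((c i : ℚ) + e)]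
      have h3 : |(c i : ℚ)| ≤ K / a i + 1 + |e| := by
        have := abs_sub ((c i : ℚ) + e) e
        rw [add_sub_cancel_right] at this
        linarith
      simp only [hN, hi, if_true]
      have h4 := h3.trans (Int.le_ceil _)
      exact_mod_cast h4
    · simp [hN, hi, hco i hi]
  exact ⟨fun i => (abs_le.1 (habs i)).1, fun i => (abs_le.1 (habs i)).2⟩

/-! ### Finiteness of the weight multiplicities -/

theorem IsWt.to_swap {G : KacMoodyAlgebra A g} {c : I → ℤ} (h : IsWt G c) :
    IsWt G.swap (-c) := by
  obtain ⟨x, hx, hx0⟩ := h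
  refine ⟨x, ?_, hx0⟩
  rw [rootComb_swap, neg_neg]
  exact hx

theorem finite_nonneg_weights (hGCM : IsGCM A) (hSym : Symmetrizable A)
    (G : KacMoodyAlgebra A g) {S : Set I} (hS : IsFiniteType (restrictM A S)) (o : I → ℤ) :
    {c : I → ℤ | IsWt G c ∧ 0 ≤ c ∧ ∀ i ∉ S, c i = o i}.Finite := by
  obtain ⟨d, hd, hsymm⟩ := exists_pos_symmetrizer hGCM hSym
  refine (finite_of_rootForm_le hGCM hd hsymm hS o
    (rootForm A d (Sᶜ.indicator o) + 2 * ∑ i, d i)).subset ?_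
  rintro c ⟨hc, hc0, hco⟩
  refine ⟨hco, ?_⟩
  have h := hc.rootForm_le hGCM hd hsymm S hc0
  rwa [show Sᶜ.indicator c = Sᶜ.indicator o from Set.indicator_congr fun i hi => hco i hi] at h

theorem finite_weights (hGCM : IsGCM A) (hSym : Symmetrizable A)
    (G : KacMoodyAlgebra A g) {S : Set I} (hS : IsFiniteType (restrictM A S)) (o : I → ℤ) :
    {c : I → ℤ | IsWt G c ∧ ∀ i ∉ S, c i = o i}.Finite := by
  refine ((finite_nonneg_weights hGCM hSym G hS o).union
    ((finite_nonneg_weights hGCM hSym G.swap hS (-o)).image Neg.neg)).subset ?_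
  rintro c ⟨hc, hco⟩
  rcases hc.nonneg_or_nonpos with h | h
  · exact Or.inl ⟨hc, h, hco⟩
  · exact Or.inr ⟨-c, ⟨hc.to_swap, neg_nonneg.2 h, fun i hi => by simp [hco i hi]⟩, neg_neg c⟩

theorem coeff_eq_zero_of_vanish (G : KacMoodyAlgebra A g) (S : Set I) {c : I → ℤ}
    (h : ∀ v ∈ hJsub G S, rootComb G c v = 0) {i : I} (hi : i ∉ S) : c i = 0 := by
  have hspan : rootComb G c ∈ Submodule.span ℂ (Set.range fun j : S => G.root j) := by
    refine mem_span_of_iInf_ker_le_ker fun v hv => h v ?_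
    simpa [hJsub, Submodule.mem_iInf] using hv
  obtain ⟨b, hb⟩ := (Submodule.mem_span_range_iff_exists_fun ℂ).1 hspan
  set b' : I → ℂ := fun j => if hj : j ∈ S then b ⟨j, hj⟩ else 0 with hb'
  have hsum : ∑ j, b' j • G.root j = rootComb G c := by
    rw [← hb, ← Finset.sum_subset (Finset.subset_univ S.toFinset) (fun j _ hj => by
      simp [hb', Set.mem_toFinset.not.1 hj]),
      Finset.sum_subtype S.toFinset (p := (· ∈ S)) (by simp)]
    exact Finset.sum_congr rfl fun j _ => by simp [hb']
  have := Fintype.linearIndependent_iff.1 G.indepRoot (fun j => (c j : ℂ) - b' j) (by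
    simp only [sub_smul, Finset.sum_sub_distrib]
    rw [hsum]
    exact sub_self _) i
  simpa [hb', hi] using this

theorem finite_words (c : I → ℤ) :
    {p : I × List I | letterCount (p.1 :: p.2) = c}.Finite := by
  rcases Set.eq_empty_or_nonempty {p : I × List I | letterCount (p.1 :: p.2) = c} with h | ⟨q, hq⟩
  · rw [h]; exact Set.finite_empty
  · refine ((List.finite_length_eq I (q.1 :: q.2).length).preimage
      (f := fun p : I × List I => p.1 :: p.2) ?_).subset ?_
    · rintro ⟨a, v⟩ - ⟨b, w⟩ - h
      simpa using h
    · intro p hp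
      refine List.Perm.length_eq (List.perm_iff_count.2 fun i => ?_)
      have h := congrFun (hp.trans hq.symm) i
      simp only [letterCount] at h
      exact_mod_cast h

/-- The inclusion of `h^S` into `g`. -/
abbrev hIncl (G : KacMoodyAlgebra A g) (S : Set I) : hJsub G S →ₗ[ℂ] g :=
  G.H.subtype ∘ₗ (hJsub G S).subtype

theorem wtSpace_le_restrict (G : KacMoodyAlgebra A g) (S : Set I) (χ : Module.Dual ℂ G.H) :
    wtSpaceι G.H.subtype χ ≤ wtSpaceι (hIncl G S) (χ ∘ₗ (hJsub G S).subtype) :=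
  fun _ hx v => hx v

theorem finiteDimensional_wtSpace (hGCM : IsGCM A) (hSym : Symmetrizable A)
    (G : KacMoodyAlgebra A g) {S : Set I} (hS : IsFiniteType (restrictM A S))
    (χ : Module.Dual ℂ (hJsub G S)) :
    FiniteDimensional ℂ (wtSpaceι (hIncl G S) χ) := by
  have := G.findimH
  set C : Set (I → ℤ) := {c | IsWt G c ∧ rootComb G c ∘ₗ (hJsub G S).subtype = χ} with hCdef
  have hC : C.Finite := by
    rcases C.eq_empty_or_nonempty with h | ⟨o, ho⟩
    · rw [h]; exact Set.finite_empty
    · refine (finite_weights hGCM hSym G hS o).subset ?_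
      rintro c ⟨hc, hcχ⟩
      refine ⟨hc, fun i hi => sub_eq_zero.1 (coeff_eq_zero_of_vanish G S (c := c - o) ?_ hi)⟩
      intro v hv
      have h := LinearMap.congr_fun (hcχ.trans ho.2.symm) ⟨v, hv⟩
      rw [map_sub, LinearMap.sub_apply]
      exact sub_eq_zero.2 h
  set Fe : Set g := ⋃ c ∈ C, (fun p : I × List I => eWord G p.1 p.2) ''
    {p | letterCount (p.1 :: p.2) = c} with hFe
  set Ff : Set g := ⋃ c ∈ C, (fun p : I × List I => eWord G.swap p.1 p.2) ''
    {p | letterCount (p.1 :: p.2) = -c} with hFf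
  have hFefin : Fe.Finite := hC.biUnion fun c _ => (finite_words c).image _
  have hFffin : Ff.Finite := hC.biUnion fun c _ => (finite_words (-c)).image _
  have hle : wtSpaceι (hIncl G S) χ ≤ G.H ⊔ Submodule.span ℂ (Fe ∪ Ff) := by
    refine (wtSpaceι_le_span (hIncl G S) (fun v w => G.abelian v w) (span_triangularSet G)
      (fun x hx => ?_) χ).trans (Submodule.span_le.2 ?_)
    · obtain ⟨c, hc⟩ := exists_rootComb_of_mem_triangularSet G hx
      exact ⟨_, wtSpace_le_restrict G S _ hc⟩
    · rintro x ⟨hxT, hxχ⟩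
      by_cases hx0 : x = 0
      · subst hx0; exact Submodule.zero_mem _
      have hmem : ∀ c, x ∈ wtSpaceι G.H.subtype (rootComb G c) → c ∈ C := fun c hc =>
        ⟨⟨x, hc, hx0⟩, weight_unique (wtSpace_le_restrict G S _ hc) hxχ hx0⟩
      rcases hxT with (hx | ⟨⟨k, w⟩, rfl⟩) | ⟨⟨k, w⟩, rfl⟩
      · exact Submodule.mem_sup_left hx
      · refine Submodule.mem_sup_right (Submodule.subset_span (Or.inl ?_))
        exact Set.mem_biUnion (hmem _ (eWord_mem_wtSpace G k w)) ⟨(k, w), rfl, rfl⟩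
      · refine Submodule.mem_sup_right (Submodule.subset_span (Or.inr ?_))
        exact Set.mem_biUnion (hmem _ (fWord_mem_wtSpace G k w))
          ⟨(k, w), (neg_neg _).symm, rfl⟩
  have := FiniteDimensional.span_of_finite ℂ (hFefin.union hFffin)
  exact Submodule.finiteDimensional_of_le hle

theorem lie_hJsub_gS (G : KacMoodyAlgebra A g) (S : Set I) {x : g} (hx : x ∈ gS G S)
    (v : hJsub G S) : ⁅hIncl G S v, x⁆ = 0 := by
  have hv : ∀ i ∈ S, G.root i v = 0 := by
    have := v.2
    simp only [hJsub, Submodule.mem_iInf, LinearMap.mem_ker] at this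
    exact this
  refine LieSubalgebra.lieSpan_induction (p := fun x _ => ⁅hIncl G S v, x⁆ = 0)
    ℂ ?_ (lie_zero _) ?_ ?_ ?_ hx
  · rintro x (⟨i, hi, rfl⟩ | ⟨i, hi, rfl⟩)
    · exact (G.lie_e v i).trans (by rw [hv i hi, zero_smul])
    · exact (G.lie_f v i).trans (by rw [hv i hi, neg_zero, zero_smul])
  · intro x y _ _ hx hy
    rw [lie_add, hx, hy, add_zero]
  · intro a x _ hx
    rw [lie_smul, hx, smul_zero]
  · intro x y _ _ hx hy
    rw [leibniz_lie, hx, hy, zero_lie, lie_zero, add_zero]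

theorem locally_nilpotent_of_mem_gS (hGCM : IsGCM A) (hSym : Symmetrizable A)
    (G : KacMoodyAlgebra A g) {S : Set I} (hS : IsFiniteType (restrictM A S)) {X : g}
    (hX : X ∈ gS G S) (h : G.H) {t : ℂ} (ht : t ≠ 0) (hhX : ⁅(h : g), X⁆ = t • X) (x : g) :
    ∃ n : ℕ, ((LieAlgebra.ad ℂ g X) ^ n) x = 0 := by
  have hle : (⨆ χ : Module.Dual ℂ G.H, wtSpaceι G.H.subtype χ) ≤
      (LieSubalgebra.engel ℂ X).toSubmodule := by
    refine iSup_le fun χ y hy => ?_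
    rw [LieSubalgebra.mem_toSubmodule, LieSubalgebra.mem_engel_iff]
    by_contra! hne
    set v : ℕ → g := fun n => ((LieAlgebra.ad ℂ g X) ^ n) y with hv
    have hsucc : ∀ n, v (n + 1) = ⁅X, v n⁆ := fun n => by
      simp only [hv]
      rw [pow_succ', Module.End.mul_apply, LieAlgebra.ad_apply]
    have hmem : ∀ n, v n ∈ wtSpaceι (hIncl G S) (χ ∘ₗ (hJsub G S).subtype) := fun n => by
      induction n with
      | zero => exact wtSpace_le_restrict G S χ hy
      | succ n ih =>
        intro w
        rw [hsucc, leibniz_lie, lie_hJsub_gS G S hX, zero_lie, zero_add, ih w, lie_smul]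
    have heig : ∀ n, ⁅(h : g), v n⁆ = (χ h + n * t) • v n := fun n => by
      induction n with
      | zero => simpa [hv] using hy h
      | succ n ih =>
        rw [hsucc, leibniz_lie, hhX, ih, smul_lie, lie_smul, ← add_smul]
        congr 1
        push_cast; ring
    have hli : LinearIndependent ℂ v := Module.End.eigenvectors_linearIndependent'
      (LieAlgebra.ad ℂ g (h : g)) (fun n : ℕ => χ h + n * t)
      (fun m n hmn => by simpa [ht] using hmn) v
      (fun n => ⟨Module.End.mem_eigenspace_iff.2 (heig n), hne n⟩)
    have := finiteDimensional_wtSpace hGCM hSym G hS (χ ∘ₗ (hJsub G S).subtype)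
    have hli' : LinearIndependent ℂ fun n =>
        (⟨v n, hmem n⟩ : wtSpaceι (hIncl G S) (χ ∘ₗ (hJsub G S).subtype)) :=
      LinearIndependent.of_comp (Submodule.subtype _) hli
    have := hli'.finite
    exact not_finite ℕ
  rw [G.weight_decomp] at hle
  exact (LieSubalgebra.mem_engel_iff ℂ _ _).1 (hle Submodule.mem_top)

end Multiplicities

end KMG

open KMG

section Statement

attribute [local instance] Classical.propDecidable

variable {I : Type*} [Fintype I] [DecidableEq I] {A : Matrix I I ℤ}
variable {g : Type*} [LieRing g] [LieAlgebra ℂ g]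

theorem statement2
    (hGCM : IsGCM A) (hInd : Indecomposable A) (hSym : Symmetrizable A)
    (G : KacMoodyAlgebra A g) (J : Set I) (D : CAdmissibleData G J) :
    (⨆ χ : Module.Dual ℂ ↥(hJsub G J),
        wtSpaceι (G.H.subtype ∘ₗ (hJsub G J).subtype) χ) = ⊤ ∧
    (∀ (k : {k : I // k ∉ J}) (x : g), ∃ n : ℕ,
        ((LieAlgebra.ad ℂ g (D.E k)) ^ n) x = 0) ∧
    (∀ (k : {k : I // k ∉ J}) (x : g), ∃ n : ℕ,
        ((LieAlgebra.ad ℂ g (D.F k)) ^ n) x = 0) ∧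
    ∀ χ : Module.Dual ℂ ↥(hJsub G J),
        FiniteDimensional ℂ ↥(wtSpaceι (G.H.subtype ∘ₗ (hJsub G J).subtype) χ) := by
  refine ⟨?_, fun k => ?_, fun k => ?_, finiteDimensional_wtSpace hGCM hSym G D.finJ⟩
  · rw [eq_top_iff, ← G.weight_decomp]
    exact iSup_le fun χ => (wtSpace_le_restrict G J χ).trans
      (le_iSup (fun μ => wtSpaceι (hIncl G J) μ) _)
  · exact locally_nilpotent_of_mem_gS hGCM hSym G (D.finIk k) (D.memE k) (D.Hc k)
      two_ne_zero ((D.sl2 k).lie_h_e_smul ℂ)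
  · exact locally_nilpotent_of_mem_gS hGCM hSym G (D.finIk k) (D.memF k) (D.Hc k)
      (neg_ne_zero.2 two_ne_zero) (by rw [(D.sl2 k).lie_lie_smul_f ℂ, neg_smul])

end Statement
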